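/- arXiv:1612.07934 — 2 statements merged into one kernel-verified Lean document; each statement's English description precedes it below -/
import Mathlib

section
/- Korn's inequality on the unit ball: there exists a constant C > 0 such that for every continuously differentiable vector field V : closure(B₁) → ℝ³, ∫_{B₁} |DV(x)|² dx ≤ C ( ∫_{B₁} |DV(x) + DV(x)ᵀ|² dx + ∫_{B₁} |V(x)|² dx ), where DV denotes the Jacobian matrix of V and |·| the Frobenius norm of a 3×3 matrix. -/
/- Korn's inequality on the unit ball `B₁ ⊆ ℝ³`:
`∫_{B₁} |DV|² ≤ C (∫_{B₁} |DV + DVᵀ|² + ∫_{B₁} |V|²)` for C¹ vector fields `V`. -/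

open MeasureTheory Metric Finset Matrix

noncomputable section

/-- ℝ³ with the Euclidean norm. -/
abbrev E3 : Type := EuclideanSpace ℝ (Fin 3)

/-- The standard basis vectors of ℝ³. -/
def e3 (i : Fin 3) : E3 := EuclideanSpace.single i 1

/-- The Jacobian matrix of a vector field `V : ℝ³ → ℝ³` at `x`. -/
def jac (V : E3 → E3) (x : E3) : Matrix (Fin 3) (Fin 3) ℝ :=
  Matrix.of fun i j => fderiv ℝ (fun y => V y i) x (e3 j)

/-- The squared Frobenius norm of a 3 × 3 real matrix. -/
def frobSq (M : Matrix (Fin 3) (Fin 3) ℝ) : ℝ := ∑ i, ∑ j, (M i j) ^ 2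


lemma korn_tendsto {K : NNReal} {f g : E3 → ℝ} (hf : LipschitzWith K f) (hg : LipschitzWith K g)
    (hfs : HasCompactSupport f) (a b : E3) : Filter.Tendsto
      (fun t : ℝ => ∫ x, (t⁻¹ • (f (x + t • a) - f x)) * (t⁻¹ • (g (x + t • b) - g x)))
      (nhdsWithin 0 (Set.Ioi 0)) (nhds (∫ x, fderiv ℝ f x a * fderiv ℝ g x b)) := by
  let S := cthickening (‖a‖) (tsupport f)
  have S_compact : IsCompact S := IsCompact.cthickening hfs
  have bd : ∀ {h : E3 → ℝ} (_ : LipschitzWith K h) (v x : E3) {t : ℝ}, 0 < t →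
      ‖t⁻¹ • (h (x + t • v) - h x)‖ ≤ K * ‖v‖ := by
    intro h hh v x t ht
    calc ‖t⁻¹ • (h (x + t • v) - h x)‖
      = (t⁻¹ * ‖h (x + t • v) - h x‖) := by simp [ht.le]
    _ ≤ (t⁻¹ * (K * ‖(x + t • v) - x‖)) := by
      gcongr; exact LipschitzWith.norm_sub_le hh (x + t • v) x
    _ = (K * ‖v‖) := by simp [field, norm_smul, abs_of_nonneg ht.le]
  have hdiff : ∀ {h : E3 → ℝ} (_ : LipschitzWith K h) (v : E3) {x : E3}, DifferentiableAt ℝ h x →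
      Filter.Tendsto (fun t : ℝ => t⁻¹ • (h (x + t • v) - h x)) (nhdsWithin 0 (Set.Ioi 0))
        (nhds (fderiv ℝ h x v)) := by
    intro h hh v x hx
    exact (hx.hasFDerivAt.hasLineDerivAt v).tendsto_slope_zero_right
  have hmeas : ∀ {h : E3 → ℝ} (_ : LipschitzWith K h) (v : E3) (t : ℝ),
      AEStronglyMeasurable (fun x => t⁻¹ • (h (x + t • v) - h x)) volume := by
    intro h hh v t
    have := hh.continuous
    exact Continuous.aestronglyMeasurable (by fun_prop)
  apply tendsto_integral_filter_of_dominated_convergence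
      (S.indicator (fun x ↦ (K * ‖a‖) * (K * ‖b‖)))
  · filter_upwards with t
    exact (hmeas hf a t).mul (hmeas hg b t)
  · filter_upwards [Ioc_mem_nhdsGT zero_lt_one] with t ht
    have t_pos : 0 < t := ht.1
    filter_upwards with x
    by_cases hx : x ∈ S
    · rw [Set.indicator_of_mem hx, norm_mul]
      exact mul_le_mul (bd hf a x t_pos) (bd hg b x t_pos) (norm_nonneg _) (by positivity)
    · have A : f x = 0 := by
        rw [← Function.notMem_support]
        contrapose hx
        exact self_subset_cthickening _ (subset_tsupport _ hx)
      have B : f (x + t • a) = 0 := by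
        rw [← Function.notMem_support]
        contrapose hx
        apply mem_cthickening_of_dist_le _ _ (‖a‖) (tsupport f) (subset_tsupport _ hx)
        simp only [dist_eq_norm, sub_add_cancel_left, norm_neg, norm_smul, Real.norm_eq_abs,
          abs_of_nonneg t_pos.le]
        exact mul_le_of_le_one_left (norm_nonneg a) ht.2
      simp only [B, A, _root_.sub_self, smul_eq_mul, mul_zero, zero_mul, norm_zero]
      exact Set.indicator_nonneg (fun y _hy ↦ by positivity) _
  · rw [integrable_indicator_iff S_compact.measurableSet]
    exact ContinuousOn.integrableOn_compact S_compact (by fun_prop)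
  · filter_upwards [hf.ae_differentiableAt, hg.ae_differentiableAt] with x hx hx'
    exact (hdiff hf a hx).mul (hdiff hg b hx')

lemma korn_commute {K : NNReal} {f g : E3 → ℝ} (hf : LipschitzWith K f) (hg : LipschitzWith K g)
    (hfs : HasCompactSupport f) (a b : E3) :
    (∫ x, fderiv ℝ f x a * fderiv ℝ g x b) = ∫ x, fderiv ℝ f x b * fderiv ℝ g x a := by
  have h1 := korn_tendsto hf hg hfs a b
  have h2 := korn_tendsto hf hg hfs (-b) (-a)
  simp only [map_neg, neg_mul_neg] at h2
  refine tendsto_nhds_unique h1 (h2.congr fun t => ?_)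
  have hcf := hf.continuous
  have hcg := hg.continuous
  have I : ∀ u v : E3, Integrable (fun x => f (x + u) * g (x + v)) := by
    intro u v
    refine Continuous.integrable_of_hasCompactSupport (by fun_prop) ?_
    refine HasCompactSupport.mul_right ?_
    exact hfs.comp_homeomorph (Homeomorph.addRight u)
  have T : ∀ u v w : E3, (∫ x, f (x + u) * g (x + v)) = ∫ x, f (x + (u + w)) * g (x + (v + w)) := by
    intro u v w
    rw [← integral_add_right_eq_self _ w]
    congr 1; funext x; congr 2 <;> abel
  have expand : ∀ u v : E3, (∫ x, (t⁻¹ • (f (x + u) - f x)) * (t⁻¹ • (g (x + v) - g x)))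
      = t⁻¹ * t⁻¹ * ((∫ x, f (x + u) * g (x + v)) - (∫ x, f (x + u) * g (x + 0))
        - (∫ x, f (x + 0) * g (x + v)) + ∫ x, f (x + 0) * g (x + 0)) := by
    intro u v
    have J1 : Integrable (fun x => f (x + u) * g (x + v) - f (x + u) * g (x + 0)) := (I _ _).sub (I _ _)
    have J2 : Integrable (fun x => f (x + u) * g (x + v) - f (x + u) * g (x + 0)
      - f (x + 0) * g (x + v)) := J1.sub (I _ _)
    rw [← integral_sub (I _ _) (I _ _), ← integral_sub J1 (I _ _),
      ← integral_add J2 (I _ _), ← integral_const_mul]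
    congr 1; funext x; simp only [smul_eq_mul, add_zero]; ring
  rw [expand, expand, T (t • -b) (t • -a) (t • a + t • b), T (t • -b) 0 (t • b), T 0 (t • -a) (t • a)]
  have e1 : t • -b + (t • a + t • b) = t • a := by simp
  have e2 : t • -a + (t • a + t • b) = t • b := by simp
  have e3' : t • -b + t • b = 0 := by simp
  have e4 : t • -a + t • a = 0 := by simp
  rw [e1, e2, e3', e4, zero_add, zero_add]
  ring
lemma lipschitz_fderiv_apply_bound {K : NNReal} {f : E3 → ℝ} (hf : LipschitzWith K f) (x v : E3) :
    |fderiv ℝ f x v| ≤ K * ‖v‖ := by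
  have h1 := norm_fderiv_le_of_lipschitz ℝ hf (x₀ := x)
  have h2 := (fderiv ℝ f x).le_opNorm v
  rw [Real.norm_eq_abs] at h2
  exact h2.trans (by gcongr)

lemma integrable_fderiv_mul {K : NNReal} {f g : E3 → ℝ} (hf : LipschitzWith K f)
    (hg : LipschitzWith K g) (hfs : HasCompactSupport f) (a b : E3) :
    Integrable (fun x => fderiv ℝ f x a * fderiv ℝ g x b) := by
  have hm : Measurable (fun x => fderiv ℝ f x a * fderiv ℝ g x b) :=
    (measurable_fderiv_apply_const ℝ f a).mul (measurable_fderiv_apply_const ℝ g b)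
  have hs : Function.support (fun x => fderiv ℝ f x a * fderiv ℝ g x b) ⊆ tsupport f := by
    intro x hx
    by_contra h
    apply hx
    have : fderiv ℝ f x = 0 := by
      by_contra h'
      exact h (support_fderiv_subset ℝ h')
    simp [this]
  rw [← integrableOn_iff_integrable_of_support_subset hs]
  refine IntegrableOn.of_bound (hfs.measure_lt_top) hm.aestronglyMeasurable ((K * ‖a‖) * (K * ‖b‖)) ?_
  refine Filter.Eventually.of_forall fun x => ?_
  rw [norm_mul]
  exact mul_le_mul (lipschitz_fderiv_apply_bound hf x a) (lipschitz_fderiv_apply_bound hg x b)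
    (norm_nonneg _) (by positivity)

lemma korn_whole {K : NNReal} {U : E3 → E3} (hU : ∀ i, LipschitzWith K (fun x => U x i))
    (hs : ∀ i, HasCompactSupport (fun x => U x i)) :
    Integrable (fun x => frobSq (jac U x)) ∧
    Integrable (fun x => frobSq (jac U x + (jac U x)ᵀ)) ∧
    (∫ x, frobSq (jac U x)) ≤ ∫ x, frobSq (jac U x + (jac U x)ᵀ) := by
  have hI : ∀ i j k l, Integrable (fun x => jac U x i j * jac U x k l) := fun i j k l => by
    simpa [jac] using integrable_fderiv_mul (hU i) (hU k) (hs i) (e3 j) (e3 l)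
  have hc : ∀ i j, (∫ x, jac U x i j * jac U x j i) = ∫ x, jac U x i i * jac U x j j := fun i j => by
    simpa [jac] using korn_commute (hU i) (hU j) (hs i) (e3 j) (e3 i)
  have e1 : (fun x => frobSq (jac U x)) = fun x => ∑ i, ∑ j, jac U x i j * jac U x i j := by
    funext x; simp [frobSq, sq]
  have e2 : (fun x => frobSq (jac U x + (jac U x)ᵀ)) = fun x => 2 * (∑ i, ∑ j, jac U x i j * jac U x i j)
      + 2 * (∑ i, ∑ j, jac U x i j * jac U x j i) := by
    funext x; simp only [frobSq, Matrix.add_apply, Matrix.transpose_apply, Fin.sum_univ_three]; ring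
  have I1 : Integrable (fun x => ∑ i, ∑ j, jac U x i j * jac U x i j) :=
    integrable_finsetSum _ fun i _ => integrable_finsetSum _ fun j _ => hI i j i j
  have I2 : Integrable (fun x => ∑ i, ∑ j, jac U x i j * jac U x j i) :=
    integrable_finsetSum _ fun i _ => integrable_finsetSum _ fun j _ => hI i j j i
  have I3 : (∫ x, ∑ i, ∑ j, jac U x i j * jac U x j i) = ∫ x, (∑ i, jac U x i i) ^ 2 := by
    have : (fun x => (∑ i, jac U x i i) ^ 2) = fun x => ∑ i, ∑ j, jac U x i i * jac U x j j := by
      funext x; rw [sq, Finset.sum_mul_sum]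
    rw [this, integral_finsetSum _ fun i _ => integrable_finsetSum _ fun j _ => hI i j j i,
      integral_finsetSum _ fun i _ => integrable_finsetSum _ fun j _ => hI i i j j]
    refine Finset.sum_congr rfl fun i _ => ?_
    rw [integral_finsetSum _ fun j _ => hI i j j i, integral_finsetSum _ fun j _ => hI i i j j]
    exact Finset.sum_congr rfl fun j _ => hc i j
  rw [e1, e2]
  refine ⟨I1, (I1.const_mul 2).add (I2.const_mul 2), ?_⟩
  rw [integral_add (I1.const_mul 2) (I2.const_mul 2), integral_const_mul, integral_const_mul, I3]
  have p1 : 0 ≤ ∫ x, (∑ i, jac U x i i) ^ 2 := integral_nonneg fun x => sq_nonneg _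
  have p2 : 0 ≤ ∫ x, ∑ i, ∑ j, jac U x i j * jac U x i j := integral_nonneg fun x =>
    Finset.sum_nonneg fun i _ => Finset.sum_nonneg fun j _ => mul_self_nonneg _
  linarith

def kq (x : E3) : ℝ := (‖x‖ ^ 2)⁻¹

def phiM (m : ℕ) (x : E3) : E3 := (kq x) ^ m • x

def MM (q : ℝ) (m : ℕ) (x : E3) (i k : Fin 3) : ℝ :=
  q ^ m * (if i = k then 1 else 0) - 2 * m * q ^ (m + 1) * (x i * x k)

lemma MM_symm (q : ℝ) (m : ℕ) (x : E3) (i k : Fin 3) : MM q m x i k = MM q m x k i := by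
  simp only [MM, mul_comm (x i), eq_comm (a := i)]

def Dphi (m : ℕ) (x : E3) : E3 →L[ℝ] E3 :=
  (kq x) ^ m • ContinuousLinearMap.id ℝ E3 -
    (2 * m * (kq x) ^ (m + 1)) • (innerSL ℝ x).smulRight x

lemma Dphi_coord (m : ℕ) (x : E3) (l j : Fin 3) : (Dphi m x (e3 j)) l = MM (kq x) m x l j := by
  have : inner ℝ x (e3 j) = x j := by
    rw [e3, EuclideanSpace.inner_single_right]; simp
  simp only [Dphi, MM, _root_.sub_apply, _root_.smul_apply, ContinuousLinearMap.id_apply,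
    ContinuousLinearMap.smulRight_apply, innerSL_apply_apply, this, PiLp.sub_apply, PiLp.smul_apply, smul_eq_mul]
  simp only [e3, PiLp.single_apply, mul_comm (x l)]

lemma kq_pos {x : E3} (hx : x ≠ 0) : 0 < kq x := by
  have := norm_pos_iff.2 hx
  unfold kq; positivity

lemma hasFDerivAt_kq {x : E3} (hx : x ≠ 0) :
    HasFDerivAt kq (-(2 * (kq x) ^ 2) • innerSL ℝ x) x := by
  have h1 := (hasStrictFDerivAt_norm_sq x).hasFDerivAt
  have hn : ‖x‖ ^ 2 ≠ 0 := by simpa using hx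
  have h2 := (hasDerivAt_inv hn).comp_hasFDerivAt x h1
  refine h2.congr_fderiv ?_
  ext v
  simp only [kq, _root_.smul_apply, innerSL_apply_apply, smul_eq_mul, nsmul_eq_mul, Nat.cast_ofNat]
  field_simp

lemma hasFDerivAt_phiM (m : ℕ) {x : E3} (hx : x ≠ 0) : HasFDerivAt (phiM m) (Dphi m x) x := by
  have h1 := ((hasFDerivAt_kq hx).pow m).smul (hasFDerivAt_id x)
  refine HasFDerivAt.congr_fderiv (f := phiM m) h1 ?_
  ext v i
  rcases m with _ | n
  · simp [Dphi]
  · simp [Dphi]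
    ring

lemma Dphi_det (m : ℕ) {x : E3} (hx : x ≠ 0) : (Dphi m x).det = (kq x) ^ (3 * m) * (1 - 2 * m) := by
  have h : (Dphi m x).det = (Matrix.of fun l j => MM (kq x) m x l j).det := by
    rw [ContinuousLinearMap.det, ← LinearMap.det_toMatrix (EuclideanSpace.basisFun (Fin 3) ℝ).toBasis]
    congr 1
    ext l j
    rw [LinearMap.toMatrix_apply]
    simp [← Dphi_coord, e3]
  have hs : kq x * (x 0 ^ 2 + x 1 ^ 2 + x 2 ^ 2) = 1 := by
    have : ‖x‖ ^ 2 = x 0 ^ 2 + x 1 ^ 2 + x 2 ^ 2 := by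
      rw [EuclideanSpace.norm_sq_eq]; simp [Fin.sum_univ_three]
    rw [← this, kq]
    exact inv_mul_cancel₀ (by simpa using hx)
  rw [h, Matrix.det_fin_three]
  simp [MM]
  rw [mul_comm 3 m, pow_mul, pow_succ]
  generalize (kq x) ^ m = r
  linear_combination (-2 * m * r ^ 3) * hs

lemma norm_phiM (n : ℕ) {x : E3} (hx : x ≠ 0) : ‖phiM (n + 1) x‖ = (‖x‖ ^ (2 * n + 1))⁻¹ := by
  have := norm_pos_iff.2 hx
  rw [phiM, norm_smul, norm_pow, Real.norm_of_nonneg (kq_pos hx).le, kq]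
  refine eq_inv_of_mul_eq_one_left ?_
  rw [inv_pow, mul_assoc, ← pow_succ', ← pow_mul]
  exact inv_mul_cancel₀ (by positivity)

lemma phiM_injOn (n : ℕ) : Set.InjOn (phiM (n + 1)) {x | x ≠ 0} := by
  intro x hx y hy h
  have h1 : ‖x‖ = ‖y‖ := by
    have := congrArg norm h
    rw [norm_phiM n hx, norm_phiM n hy, _root_.inv_inj] at this
    exact (pow_left_inj₀ (norm_nonneg _) (norm_nonneg _) (by omega)).1 this
  have h2 : kq x = kq y := by rw [kq, kq, h1]
  simp only [phiM, h2] at h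
  exact smul_right_injective E3 (pow_pos (kq_pos hy) _).ne' h

def ann : Set E3 := {x | 1 < ‖x‖ ∧ ‖x‖ < 3}

lemma ann_ne {x : E3} (hx : x ∈ ann) : x ≠ 0 := by
  rintro rfl
  have := hx.1
  simp at this
  linarith

lemma isOpen_ann : IsOpen ann :=
  (isOpen_lt continuous_const continuous_norm).inter (isOpen_lt continuous_norm continuous_const)

lemma phiM_mem (n : ℕ) {x : E3} (hx : 1 < ‖x‖) : phiM (n + 1) x ∈ ball (0 : E3) 1 := by
  have hx0 : x ≠ 0 := by rintro rfl; simp at hx; linarith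
  rw [mem_ball_zero_iff, norm_phiM n hx0]
  exact inv_lt_one_of_one_lt₀ (one_lt_pow₀ hx (by omega))

lemma korn_cov (n : ℕ) : ∃ C > (0 : ℝ), ∀ F H : E3 → ℝ, (∀ x, 0 ≤ F x) → IntegrableOn F (ball 0 1) →
    (∀ x ∈ ann, 0 ≤ H x) → (∀ x ∈ ann, H x ≤ F (phiM (n + 1) x)) →
    (∫ x in ann, H x) ≤ C * ∫ x in ball (0 : E3) 1, F x := by
  refine ⟨9 ^ (3 * (n + 1)), by positivity, fun F H hF hFi hH hHF => ?_⟩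
  have hd : ∀ x ∈ ann, HasFDerivWithinAt (phiM (n + 1)) (Dphi (n + 1) x) ann x := fun x hx =>
    (hasFDerivAt_phiM _ (ann_ne hx)).hasFDerivWithinAt
  have hinj : Set.InjOn (phiM (n + 1)) ann := (phiM_injOn n).mono fun x hx => ann_ne hx
  have himg : phiM (n + 1) '' ann ⊆ ball 0 1 := by
    rintro _ ⟨x, hx, rfl⟩; exact phiM_mem n hx.1
  have h1 := integral_image_eq_integral_abs_det_fderiv_smul volume isOpen_ann.measurableSet hd hinj F
  have h2 := (integrableOn_image_iff_integrableOn_abs_det_fderiv_smul volume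
    isOpen_ann.measurableSet hd hinj F).1 (hFi.mono_set himg)
  have h3 : (∫ x in phiM (n + 1) '' ann, F x) ≤ ∫ x in ball (0 : E3) 1, F x :=
    setIntegral_mono_set hFi (Filter.Eventually.of_forall hF) (Filter.Eventually.of_forall himg)
  have h4 : (∫ x in ann, H x) ≤ ∫ x in ann, 9 ^ (3 * (n + 1)) * (|(Dphi (n + 1) x).det| • F (phiM (n + 1) x)) := by
    refine integral_mono_of_nonneg ?_ (h2.const_mul _) ?_
    · exact (ae_restrict_iff' isOpen_ann.measurableSet).2 (Filter.Eventually.of_forall hH)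
    · refine (ae_restrict_iff' isOpen_ann.measurableSet).2 (Filter.Eventually.of_forall fun x hx => ?_)
      refine (hHF x hx).trans ?_
      simp only [smul_eq_mul]
      rw [← mul_assoc]
      refine le_mul_of_one_le_left (hF _) ?_
      have hq := kq_pos (ann_ne hx)
      rw [Dphi_det _ (ann_ne hx), abs_mul, abs_of_pos (pow_pos hq _), ← mul_assoc, ← mul_pow]
      have hq9 : 1 ≤ 9 * kq x := by
        have h0 := hx.1
        have h3 := hx.2
        rw [kq, ← div_eq_mul_inv, one_le_div (by positivity)]
        nlinarith
      have a1 : (1 : ℝ) ≤ |1 - 2 * ((n + 1 : ℕ) : ℝ)| := by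
        push_cast
        rw [abs_of_nonpos] <;> linarith [(Nat.cast_nonneg n : (0 : ℝ) ≤ n)]
      exact one_le_mul_of_one_le_of_one_le (one_le_pow₀ hq9) a1
  rw [integral_const_mul, ← h1] at h4
  exact h4.trans (by gcongr)

def Wc (χ : E3 → ℝ) (V : E3 → E3) (q : E3 → ℝ) (m : ℕ) (x : E3) (i : Fin 3) : ℝ :=
  ∑ k, (χ x * MM (q x) m x i k) * V ((q x) ^ m • x) k

lemma contDiffAt_kq {x : E3} (hx : x ≠ 0) : ContDiffAt ℝ 2 kq x := by
  have hn : ‖x‖ ^ 2 ≠ 0 := by simpa using hx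
  exact ((contDiff_norm_sq ℝ).contDiffAt).inv hn

lemma contDiffAt_A {χ : E3 → ℝ} (hχ : ContDiff ℝ 2 χ) (m : ℕ) (i k : Fin 3) {x : E3} (hx : x ≠ 0) :
    ContDiffAt ℝ 2 (fun y => χ y * MM (kq y) m y i k) x := by
  have h1 := contDiffAt_kq hx
  have h2 := hχ.contDiffAt (x := x)
  have h3 : ∀ j : Fin 3, ContDiffAt ℝ 2 (fun y : E3 => y j) x := fun j =>
    ((EuclideanSpace.proj j : E3 →L[ℝ] ℝ).contDiff).contDiffAt
  have h4 := h3 i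
  have h5 := h3 k
  unfold MM
  fun_prop

lemma jac_expand (V : E3 → E3) (y w : E3) (k : Fin 3) :
    fderiv ℝ (fun z => V z k) y w = ∑ l, w l * jac V y k l := by
  have : w = ∑ l, w l • e3 l := by
    ext i
    simp [e3, Finset.sum_apply, Pi.single_apply]
  conv_lhs => rw [this]
  simp [jac]

lemma Wc_hasFDerivAt {χ : E3 → ℝ} (hχ : ContDiff ℝ 2 χ) {V : E3 → E3}
    (hV : ∀ y ∈ ball (0 : E3) 1, DifferentiableAt ℝ V y) (n : ℕ) {x : E3} (hx : x ∈ ann) (i : Fin 3) :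
    DifferentiableAt ℝ (fun y => Wc χ V kq (n + 1) y i) x ∧ ∀ j,
    fderiv ℝ (fun y => Wc χ V kq (n + 1) y i) x (e3 j) =
      ∑ k, (fderiv ℝ (fun y => χ y * MM (kq y) (n + 1) y i k) x (e3 j) * V (phiM (n + 1) x) k
        + (χ x * MM (kq x) (n + 1) x i k) *
          ∑ l, MM (kq x) (n + 1) x l j * jac V (phiM (n + 1) x) k l) := by
  have hx0 := ann_ne hx
  have hVk : ∀ k, HasFDerivAt (fun y => V (phiM (n + 1) y) k)
      ((fderiv ℝ (fun z => V z k) (phiM (n + 1) x)).comp (Dphi (n + 1) x)) x := by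
    intro k
    have hd : DifferentiableAt ℝ (fun z => V z k) (phiM (n + 1) x) :=
      ((EuclideanSpace.proj k : E3 →L[ℝ] ℝ).differentiableAt).comp _ (hV _ (phiM_mem n hx.1))
    exact hd.hasFDerivAt.comp x (hasFDerivAt_phiM (n + 1) hx0)
  have hA : ∀ k, HasFDerivAt (fun y => χ y * MM (kq y) (n + 1) y i k) _ x := fun k =>
    ((contDiffAt_A hχ (n + 1) i k hx0).differentiableAt (by norm_num)).hasFDerivAt
  have hs := HasFDerivAt.fun_sum (u := Finset.univ) fun k _ => (hA k).mul (hVk k)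
  have hs' : HasFDerivAt (fun y => Wc χ V kq (n + 1) y i) _ x := hs
  refine ⟨hs'.differentiableAt, fun j => ?_⟩
  rw [hs'.fderiv, _root_.sum_apply]
  refine Finset.sum_congr rfl fun k _ => ?_
  simp only [_root_.add_apply, _root_.smul_apply, ContinuousLinearMap.comp_apply, smul_eq_mul, jac_expand,
    Dphi_coord]
  ring

lemma ann_bound {ι : Type*} [Fintype ι] {f : E3 → ι → ℝ}
    (hf : ∀ i, ∀ x : E3, x ≠ 0 → ContinuousAt (fun x => f x i) x) :
    ∃ K > (0 : ℝ), ∀ x ∈ ann, ∀ i, |f x i| ≤ K := by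
  have hc : IsCompact (closedBall (0 : E3) 3 \ ball 0 1) := (isCompact_closedBall _ _).diff isOpen_ball
  have hcont : ContinuousOn f (closedBall (0 : E3) 3 \ ball 0 1) := by
    refine continuousOn_pi.2 fun i x hx => (hf i x ?_).continuousWithinAt
    rintro rfl
    simp at hx
  obtain ⟨K, hK⟩ := hc.exists_bound_of_continuousOn hcont
  refine ⟨max K 1, by positivity, fun x hx i => ?_⟩
  refine (norm_le_pi_norm (f x) i).trans ((hK x ?_).trans (le_max_left _ _))
  simp only [Set.mem_sdiff, mem_closedBall_zero_iff, mem_ball_zero_iff, not_lt]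
  exact ⟨hx.2.le, hx.1.le⟩

lemma frobSq_entry (M : Matrix (Fin 3) (Fin 3) ℝ) (i j : Fin 3) : |M i j| ≤ Real.sqrt (frobSq M) := by
  refine Real.abs_le_sqrt ?_
  calc M i j ^ 2 ≤ ∑ j, M i j ^ 2 :=
        Finset.single_le_sum (f := fun j => M i j ^ 2) (fun _ _ => sq_nonneg _) (Finset.mem_univ j)
    _ ≤ frobSq M := Finset.single_le_sum (f := fun i => ∑ j, M i j ^ 2)
        (fun _ _ => Finset.sum_nonneg fun _ _ => sq_nonneg _) (Finset.mem_univ i)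

lemma frobSq_nonneg (M : Matrix (Fin 3) (Fin 3) ℝ) : 0 ≤ frobSq M :=
  Finset.sum_nonneg fun _ _ => Finset.sum_nonneg fun _ _ => sq_nonneg _

lemma Wc_bound {χ : E3 → ℝ} (hχ : ContDiff ℝ 2 χ) (n : ℕ) :
    ∃ C > (0 : ℝ), ∀ V : E3 → E3, (∀ y ∈ ball (0 : E3) 1, DifferentiableAt ℝ V y) →
    ∀ x ∈ ann, ∀ i j, (fderiv ℝ (fun y => Wc χ V kq (n + 1) y i) x (e3 j) +
        fderiv ℝ (fun y => Wc χ V kq (n + 1) y j) x (e3 i)) ^ 2 ≤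
      C * (frobSq (jac V (phiM (n + 1) x) + (jac V (phiM (n + 1) x))ᵀ) + ‖V (phiM (n + 1) x)‖ ^ 2) := by
  obtain ⟨K, hK0, hK⟩ := ann_bound (ι := Fin 3 × Fin 3 × Fin 3)
    (f := fun x p => fderiv ℝ (fun y => χ y * MM (kq y) (n + 1) y p.1 p.2.1) x (e3 p.2.2)) (by
      intro p x hx
      have h1 : ContDiffAt ℝ 1 (fderiv ℝ (fun y => χ y * MM (kq y) (n + 1) y p.1 p.2.1)) x :=
        (contDiffAt_A hχ (n + 1) p.1 p.2.1 hx).fderiv_right (by norm_num)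
      exact h1.continuousAt.clm_apply continuousAt_const)
  obtain ⟨L, hL0, hL⟩ := ann_bound (ι := Fin 3 × Fin 3 × Fin 3 × Fin 3)
    (f := fun x p => χ x * MM (kq x) (n + 1) x p.1 p.2.1 * MM (kq x) (n + 1) x p.2.2.1 p.2.2.2) (by
      intro p x hx
      exact (contDiffAt_A hχ (n + 1) p.1 p.2.1 hx).continuousAt.mul
        (by simpa using (contDiffAt_A (χ := fun _ => 1) contDiff_const (n + 1) p.2.2.1 p.2.2.2 hx).continuousAt))
  refine ⟨2 * ((6 * K) ^ 2 + (9 * L) ^ 2), by positivity, fun V hV x hx i j => ?_⟩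
  rw [(Wc_hasFDerivAt hχ hV n hx i).2, (Wc_hasFDerivAt hχ hV n hx j).2]
  set y := phiM (n + 1) x
  set S := jac V y + (jac V y)ᵀ with hS
  have hid : (∑ k, (fderiv ℝ (fun y => χ y * MM (kq y) (n + 1) y i k) x (e3 j) * V y k
        + (χ x * MM (kq x) (n + 1) x i k) * ∑ l, MM (kq x) (n + 1) x l j * jac V y k l)) +
      (∑ k, (fderiv ℝ (fun y => χ y * MM (kq y) (n + 1) y j k) x (e3 i) * V y k
        + (χ x * MM (kq x) (n + 1) x j k) * ∑ l, MM (kq x) (n + 1) x l i * jac V y k l)) =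
      (∑ k, (fderiv ℝ (fun y => χ y * MM (kq y) (n + 1) y i k) x (e3 j) +
        fderiv ℝ (fun y => χ y * MM (kq y) (n + 1) y j k) x (e3 i)) * V y k) +
      ∑ k, ∑ l, (χ x * MM (kq x) (n + 1) x i k * MM (kq x) (n + 1) x l j) * S k l := by
    have hsw : (∑ k, (χ x * MM (kq x) (n + 1) x j k) * ∑ l, MM (kq x) (n + 1) x l i * jac V y k l)
        = ∑ k, ∑ l, (χ x * MM (kq x) (n + 1) x i k * MM (kq x) (n + 1) x l j) * jac V y l k := by
      simp only [Finset.mul_sum]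
      rw [Finset.sum_comm]
      refine Finset.sum_congr rfl fun k _ => Finset.sum_congr rfl fun l _ => ?_
      rw [MM_symm _ _ _ j l, MM_symm _ _ _ k i]
      ring
    simp only [Finset.sum_add_distrib, hsw, hS, Matrix.add_apply, Matrix.transpose_apply, mul_add, add_mul]
    simp only [Finset.mul_sum, mul_assoc]
    ring
  rw [hid]
  set s := Real.sqrt (frobSq S)
  have hs2 : frobSq S = s ^ 2 := (Real.sq_sqrt (frobSq_nonneg S)).symm
  have b1 : |∑ k, (fderiv ℝ (fun y => χ y * MM (kq y) (n + 1) y i k) x (e3 j) +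
        fderiv ℝ (fun y => χ y * MM (kq y) (n + 1) y j k) x (e3 i)) * V y k| ≤ 6 * K * ‖V y‖ := by
    refine (Finset.abs_sum_le_sum_abs _ _).trans ?_
    have : ∀ k ∈ (Finset.univ : Finset (Fin 3)), |(fderiv ℝ (fun y => χ y * MM (kq y) (n + 1) y i k) x (e3 j) +
        fderiv ℝ (fun y => χ y * MM (kq y) (n + 1) y j k) x (e3 i)) * V y k| ≤ (K + K) * ‖V y‖ := by
      intro k _
      rw [abs_mul]
      refine mul_le_mul ((abs_add_le _ _).trans (add_le_add (hK x hx (i, k, j)) (hK x hx (j, k, i))))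
        (PiLp.norm_apply_le (V y) k) (abs_nonneg _) (by positivity)
    refine (Finset.sum_le_sum this).trans (le_of_eq ?_)
    simp
    ring
  have b2 : |∑ k, ∑ l, (χ x * MM (kq x) (n + 1) x i k * MM (kq x) (n + 1) x l j) * S k l| ≤ 9 * L * s := by
    refine (Finset.abs_sum_le_sum_abs _ _).trans ?_
    have : ∀ k ∈ (Finset.univ : Finset (Fin 3)), |∑ l, (χ x * MM (kq x) (n + 1) x i k *
        MM (kq x) (n + 1) x l j) * S k l| ≤ 3 * (L * s) := by
      intro k _
      refine (Finset.abs_sum_le_sum_abs _ _).trans ?_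
      have : ∀ l ∈ (Finset.univ : Finset (Fin 3)), |(χ x * MM (kq x) (n + 1) x i k *
        MM (kq x) (n + 1) x l j) * S k l| ≤ L * s := by
        intro l _
        rw [abs_mul]
        exact mul_le_mul (hL x hx (i, k, l, j)) (frobSq_entry S k l) (abs_nonneg _) hL0.le
      refine (Finset.sum_le_sum this).trans (le_of_eq ?_)
      simp
    refine (Finset.sum_le_sum this).trans (le_of_eq ?_)
    simp
    ring
  have hs0 : 0 ≤ s := Real.sqrt_nonneg _
  rw [hs2]
  have hv := norm_nonneg (V y)
  set a := ∑ k, (fderiv ℝ (fun y => χ y * MM (kq y) (n + 1) y i k) x (e3 j) +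
        fderiv ℝ (fun y => χ y * MM (kq y) (n + 1) y j k) x (e3 i)) * V y k
  set b := ∑ k, ∑ l, (χ x * MM (kq x) (n + 1) x i k * MM (kq x) (n + 1) x l j) * S k l
  have c1 : a ^ 2 ≤ (6 * K * ‖V y‖) ^ 2 := sq_le_sq' (by linarith [abs_le.1 b1]) (abs_le.1 b1).2
  have c2 : b ^ 2 ≤ (9 * L * s) ^ 2 := sq_le_sq' (by linarith [abs_le.1 b2]) (abs_le.1 b2).2
  have c3 : (a + b) ^ 2 ≤ 2 * (a ^ 2 + b ^ 2) := by nlinarith [sq_nonneg (a - b)]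
  have c4 : 0 ≤ (6 * K) ^ 2 * s ^ 2 := by positivity
  have c5 : 0 ≤ (9 * L) ^ 2 * ‖V y‖ ^ 2 := by positivity
  nlinarith

def gq (x : E3) : ℝ := (max 1 (‖x‖ ^ 2))⁻¹

lemma gq_locLip : LocallyLipschitz gq := by
  have h1 : LipschitzWith 1 (fun t : ℝ => (max 1 t)⁻¹) := by
    refine LipschitzWith.of_dist_le_mul fun s t => ?_
    have hs : 1 ≤ max 1 s := le_max_left _ _
    have ht : 1 ≤ max 1 t := le_max_left _ _
    have hst : |max 1 t - max 1 s| ≤ |t - s| := by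
      simpa [max_comm] using abs_max_sub_max_le_abs t s 1
    rw [Real.dist_eq, Real.dist_eq, inv_sub_inv (by positivity) (by positivity), abs_div,
      abs_of_pos (show 0 < max 1 s * max 1 t by positivity), NNReal.coe_one, one_mul, abs_sub_comm s t]
    refine (div_le_self (abs_nonneg _) ?_).trans hst
    exact one_le_mul_of_one_le_of_one_le hs ht
  exact h1.locallyLipschitz.comp ((contDiff_norm_sq ℝ (n := 1)).locallyLipschitz)

lemma gq_of_le {x : E3} (hx : ‖x‖ ≤ 1) : gq x = 1 := by
  have : ‖x‖ ^ 2 ≤ 1 := pow_le_one₀ (norm_nonneg _) hx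
  rw [gq, max_eq_left this, inv_one]

lemma gq_of_ge {x : E3} (hx : 1 ≤ ‖x‖) : gq x = kq x := by
  rw [gq, max_eq_right (one_le_pow₀ hx), kq]

def Uf (χ : E3 → ℝ) (V : E3 → E3) (x : E3) : E3 :=
  WithLp.toLp 2 fun i => 2 * Wc χ V gq 1 x i - Wc χ V gq 2 x i

lemma Uf_apply (χ : E3 → ℝ) (V : E3 → E3) (x : E3) (i : Fin 3) :
  Uf χ V x i = 2 * Wc χ V gq 1 x i - Wc χ V gq 2 x i := rfl

lemma Uf_inside {χ : E3 → ℝ} {x : E3} (hχ : χ x = 1) (hx : ‖x‖ ≤ 1) (V : E3 → E3) : Uf χ V x = V x := by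
  ext i
  rw [Uf_apply]
  simp only [Wc, MM, gq_of_le hx, hχ, one_pow, one_smul, Fin.sum_univ_three]
  fin_cases i <;> simp <;> ring

lemma Wc_locLip {χ : E3 → ℝ} (hχ : ContDiff ℝ 2 χ) {V : E3 → E3} {K : NNReal} (hV : LipschitzWith K V)
    (m : ℕ) (i : Fin 3) : LocallyLipschitz (fun x => Wc χ V gq m x i) := by
  have h1 : ContDiff ℝ 1 (fun p : E3 × ℝ × E3 => ∑ k, (χ p.1 * MM p.2.1 m p.1 i k) * p.2.2 k) := by
    have hp : ∀ j : Fin 3, ContDiff ℝ 1 (fun y : E3 => y j) := fun j =>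
      ((EuclideanSpace.proj j : E3 →L[ℝ] ℝ).contDiff)
    have hp1 : ∀ j : Fin 3, ContDiff ℝ 1 (fun p : E3 × ℝ × E3 => p.1 j) := fun j =>
      (hp j).comp contDiff_fst
    have hp2 : ∀ j : Fin 3, ContDiff ℝ 1 (fun p : E3 × ℝ × E3 => p.2.2 j) := fun j =>
      (hp j).comp (contDiff_snd.comp contDiff_snd)
    have hc : ContDiff ℝ 1 χ := hχ.of_le (by norm_num)
    unfold MM
    refine ContDiff.sum fun k _ => ?_
    have a1 := hp1 i
    have a2 := hp1 k
    have a3 := hp2 k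
    fun_prop
  have h2 : LocallyLipschitz (fun x : E3 => (gq x) ^ m • x) := by
    have : ContDiff ℝ 1 (fun p : ℝ × E3 => p.1 ^ m • p.2) := by fun_prop
    have h3 : LocallyLipschitz (fun x : E3 => (gq x, x)) := gq_locLip.prodMk LocallyLipschitz.id
    have h4 := this.locallyLipschitz
    have h5 := LocallyLipschitz.comp h4 h3
    exact h5
  have h3 : LocallyLipschitz (fun x : E3 => V ((gq x) ^ m • x)) :=
    LocallyLipschitz.comp hV.locallyLipschitz h2
  have h4 : LocallyLipschitz (fun x : E3 => (gq x, V ((gq x) ^ m • x))) := gq_locLip.prodMk h3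
  have h5 : LocallyLipschitz (fun x : E3 => (x, gq x, V ((gq x) ^ m • x))) :=
    LocallyLipschitz.id.prodMk h4
  have h6 := h1.locallyLipschitz
  have h7 := LocallyLipschitz.comp h6 h5
  exact h7

lemma Uf_locLip {χ : E3 → ℝ} (hχ : ContDiff ℝ 2 χ) {V : E3 → E3} {K : NNReal} (hV : LipschitzWith K V)
    (i : Fin 3) : LocallyLipschitz (fun x => Uf χ V x i) := by
  have : ContDiff ℝ 1 (fun p : ℝ × ℝ => 2 * p.1 - p.2) := by fun_prop
  exact this.locallyLipschitz.comp ((Wc_locLip hχ hV 1 i).prodMk (Wc_locLip hχ hV 2 i))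

lemma lip_of_locLip {f : E3 → ℝ} (hf : LocallyLipschitz f) (h0 : ∀ x, 2 ≤ ‖x‖ → f x = 0) :
    ∃ K : NNReal, LipschitzWith K f := by
  obtain ⟨K, hK⟩ := hf.locallyLipschitzOn.exists_lipschitzOnWith_of_compact (isCompact_closedBall (0 : E3) 3)
  obtain ⟨B, hB⟩ := (isCompact_closedBall (0 : E3) 3).exists_bound_of_continuousOn hf.continuous.continuousOn
  have hB0 : 0 ≤ B := (norm_nonneg _).trans (hB 0 (by simp))
  have hbd : ∀ x, ‖f x‖ ≤ B := by
    intro x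
    by_cases hx : ‖x‖ ≤ 3
    · exact hB x (by simpa using hx)
    · rw [h0 x (by linarith), norm_zero]; exact hB0
  have main : ∀ x y, ‖x‖ ≤ 2 → 3 < ‖y‖ → dist (f x) (f y) ≤ B * dist x y := by
    intro x y hx hy
    rw [h0 y (by linarith), dist_zero_right]
    have : 1 ≤ dist x y := by
      rw [dist_comm, dist_eq_norm]; linarith [norm_sub_norm_le y x]
    exact (hbd x).trans (le_mul_of_one_le_right hB0 this)
  refine ⟨K + B.toNNReal, LipschitzWith.of_dist_le_mul fun x y => ?_⟩
  have hc : ((K + B.toNNReal : NNReal) : ℝ) = K + B := by simp [hB0]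
  rw [hc, add_mul]
  have p1 : 0 ≤ (K : ℝ) * dist x y := by positivity
  have p2 : 0 ≤ B * dist x y := by positivity
  by_cases hx : ‖x‖ ≤ 3
  · by_cases hy : ‖y‖ ≤ 3
    · have := hK.dist_le_mul x (by simpa using hx) y (by simpa using hy)
      linarith
    · by_cases hx2 : ‖x‖ ≤ 2
      · linarith [main x y hx2 (not_le.1 hy)]
      · rw [h0 x (by linarith), h0 y (by linarith), dist_self]; linarith
  · by_cases hy2 : ‖y‖ ≤ 2
    · have := main y x hy2 (not_le.1 hx)
      rw [dist_comm (f x), dist_comm x] at *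
      linarith
    · rw [h0 x (by linarith), h0 y (by linarith), dist_self]; linarith

lemma exists_cutoff : ∃ χ : E3 → ℝ, ContDiff ℝ 2 χ ∧ (∀ x, ‖x‖ ≤ 1 → χ x = 1) ∧
    ∀ x, 2 ≤ ‖x‖ → χ x = 0 := by
  let b : ContDiffBump (0 : E3) := ⟨1, 2, by norm_num, by norm_num⟩
  refine ⟨b, b.contDiff, fun x hx => b.one_of_mem_closedBall (by simpa using hx), fun x hx => ?_⟩
  exact b.zero_of_le_dist (by simpa [dist_eq_norm] using hx)

lemma Uf_zero {χ : E3 → ℝ} {x : E3} (h : χ x = 0) (V : E3 → E3) : Uf χ V x = 0 := by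
  ext i
  rw [Uf_apply]
  simp [Wc, h]

lemma jac_congr {U V : E3 → E3} {x : E3} (h : U =ᶠ[nhds x] V) : jac U x = jac V x := by
  ext i j
  simp only [jac, Matrix.of_apply]
  have h' : (fun y => U y i) =ᶠ[nhds x] fun y => V y i := h.mono fun y hy => by simp only [hy]
  rw [h'.fderiv_eq]

lemma frobSq_sub (A B : Matrix (Fin 3) (Fin 3) ℝ) (c d : ℝ) (h : ∀ i j, (A i j) ^ 2 ≤ c)
   (h' : ∀ i j, (B i j) ^ 2 ≤ d) : frobSq ((2 : ℝ) • A - B) ≤ 72 * c + 18 * d := by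
  have : ∀ i j, (((2 : ℝ) • A - B) i j) ^ 2 ≤ 8 * c + 2 * d := by
    intro i j
    simp only [Matrix.sub_apply, Matrix.smul_apply, smul_eq_mul]
    nlinarith [h i j, h' i j, sq_nonneg (2 * A i j + B i j)]
  unfold frobSq
  refine (Finset.sum_le_sum fun i _ => Finset.sum_le_sum fun j _ => this i j).trans (le_of_eq ?_)
  simp
  ring

lemma Uf_bound {χ : E3 → ℝ} (hχ : ContDiff ℝ 2 χ) :
    ∃ C > (0 : ℝ), ∀ V : E3 → E3, (∀ y ∈ ball (0 : E3) 1, DifferentiableAt ℝ V y) →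
    ∀ x ∈ ann, frobSq (jac (Uf χ V) x + (jac (Uf χ V) x)ᵀ) ≤
      C * (frobSq (jac V (phiM 1 x) + (jac V (phiM 1 x))ᵀ) + ‖V (phiM 1 x)‖ ^ 2) +
      C * (frobSq (jac V (phiM 2 x) + (jac V (phiM 2 x))ᵀ) + ‖V (phiM 2 x)‖ ^ 2) := by
  obtain ⟨C1, hC1, h1⟩ := Wc_bound hχ 0
  obtain ⟨C2, hC2, h2⟩ := Wc_bound hχ 1
  refine ⟨72 * C1 + 18 * C2, by positivity, fun V hV x hx => ?_⟩
  let A : Matrix (Fin 3) (Fin 3) ℝ := Matrix.of fun i j =>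
    fderiv ℝ (fun y => Wc χ V kq 1 y i) x (e3 j) + fderiv ℝ (fun y => Wc χ V kq 1 y j) x (e3 i)
  let B : Matrix (Fin 3) (Fin 3) ℝ := Matrix.of fun i j =>
    fderiv ℝ (fun y => Wc χ V kq 2 y i) x (e3 j) + fderiv ℝ (fun y => Wc χ V kq 2 y j) x (e3 i)
  have hfd : ∀ i j, jac (Uf χ V) x i j = 2 * fderiv ℝ (fun y => Wc χ V kq 1 y i) x (e3 j) -
      fderiv ℝ (fun y => Wc χ V kq 2 y i) x (e3 j) := by
    intro i j
    have he : (fun y => Uf χ V y i) =ᶠ[nhds x] fun y => 2 * Wc χ V kq 1 y i - Wc χ V kq 2 y i := by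
      filter_upwards [isOpen_ann.mem_nhds hx] with y hy
      simp only [Uf_apply, Wc, gq_of_ge hy.1.le]
    have hd := (((Wc_hasFDerivAt hχ hV 0 hx i).1.hasFDerivAt.const_mul 2).sub
      (Wc_hasFDerivAt hχ hV 1 hx i).1.hasFDerivAt)
    have hd' : HasFDerivAt (fun y => 2 * Wc χ V kq 1 y i - Wc χ V kq 2 y i) _ x := hd
    simp only [jac, Matrix.of_apply]
    rw [he.fderiv_eq, hd'.fderiv]
    simp
  have hE : jac (Uf χ V) x + (jac (Uf χ V) x)ᵀ = (2 : ℝ) • A - B := by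
    ext i j
    simp only [Matrix.add_apply, Matrix.transpose_apply, hfd, Matrix.sub_apply, Matrix.smul_apply, A, B,
      Matrix.of_apply, smul_eq_mul]
    ring
  rw [hE]
  refine (frobSq_sub A B _ _ (h1 V hV x hx) (h2 V hV x hx)).trans ?_
  have q1 := frobSq_nonneg (jac V (phiM 1 x) + (jac V (phiM 1 x))ᵀ)
  have q2 := frobSq_nonneg (jac V (phiM 2 x) + (jac V (phiM 2 x))ᵀ)
  have q3 := sq_nonneg ‖V (phiM 1 x)‖
  have q4 := sq_nonneg ‖V (phiM 2 x)‖
  simp only [zero_add, one_add_one_eq_two]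
  nlinarith [mul_nonneg hC1.le (add_nonneg q2 q4), mul_nonneg hC2.le (add_nonneg q1 q3)]

lemma measurable_phiM (m : ℕ) : Measurable (phiM m) := by
  unfold phiM kq
  fun_prop

lemma measurable_frobSq_jac (V : E3 → E3) :
    Measurable (fun x => frobSq (jac V x + (jac V x)ᵀ)) := by
  have : ∀ i j, Measurable (fun x => jac V x i j) := fun i j =>
    measurable_fderiv_apply_const ℝ (fun y => V y i) (e3 j)
  simp only [frobSq, Matrix.add_apply, Matrix.transpose_apply]
  fun_prop

lemma korn_lipschitz : ∃ C > (0 : ℝ), ∀ (V : E3 → E3) (K : NNReal), LipschitzWith K V →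
    (∀ y ∈ ball (0 : E3) 1, DifferentiableAt ℝ V y) →
      (∫ x in ball (0 : E3) 1, frobSq (jac V x)) ≤
        C * ((∫ x in ball (0 : E3) 1, frobSq (jac V x + (jac V x)ᵀ)) +
          ∫ x in ball (0 : E3) 1, ‖V x‖ ^ 2) := by
  obtain ⟨χ, hχ, hχ1, hχ0⟩ := exists_cutoff
  obtain ⟨C, hC, hb⟩ := Uf_bound hχ
  obtain ⟨C1, hC1, hc1⟩ := korn_cov 0
  obtain ⟨C2, hC2, hc2⟩ := korn_cov 1
  refine ⟨1 + C1 * C + C2 * C, by positivity, fun V K hV hVd => ?_⟩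
  set U := Uf χ V with hU
  -- Lipschitz and compact support
  have hL : ∀ i, ∃ K : NNReal, LipschitzWith K (fun x => U x i) := fun i =>
    lip_of_locLip (Uf_locLip hχ hV i) fun x hx => by simp [hU, Uf_zero (hχ0 x hx)]
  choose L hL using hL
  have hL' : ∀ i, LipschitzWith (∑ i, L i) (fun x => U x i) := fun i =>
    (hL i).weaken (Finset.single_le_sum (fun _ _ => zero_le) (Finset.mem_univ i))
  have hcs : ∀ i, HasCompactSupport (fun x => U x i) := fun i =>
    HasCompactSupport.intro (isCompact_closedBall (0 : E3) 2) fun x hx => by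
      have : 2 ≤ ‖x‖ := by
        have := hx
        simp only [mem_closedBall_zero_iff, not_le] at this
        exact this.le
      simp [hU, Uf_zero (hχ0 x this)]
  obtain ⟨i1, i2, hk⟩ := korn_whole hL' hcs
  -- inside
  have hin : ∀ x ∈ ball (0 : E3) 1, jac U x = jac V x := fun x hx => by
    refine jac_congr ?_
    filter_upwards [isOpen_ball.mem_nhds hx] with y hy
    have hy' : ‖y‖ ≤ 1 := by simpa using (mem_ball_zero_iff.1 hy).le
    exact Uf_inside (hχ1 y hy') hy' V
  -- outside
  have hout : ∀ x : E3, 2 < ‖x‖ → jac U x = 0 := fun x hx => by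
    have : U =ᶠ[nhds x] fun _ => 0 := by
      filter_upwards [(isOpen_lt continuous_const continuous_norm).mem_nhds hx] with y hy
      exact Uf_zero (hχ0 y (le_of_lt hy)) V
    rw [jac_congr this]
    ext i j
    simp [jac]
  set F : E3 → ℝ := fun y => frobSq (jac V y + (jac V y)ᵀ) + ‖V y‖ ^ 2 with hF
  have hF0 : ∀ y, 0 ≤ F y := fun y => add_nonneg (frobSq_nonneg _) (sq_nonneg _)
  have hVm : Measurable (fun y => ‖V y‖ ^ 2) := by
    have := hV.continuous.measurable
    fun_prop
  have hFm : Measurable F := (measurable_frobSq_jac V).add hVm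
  have hVi : ∀ i, LipschitzWith K (fun x => V x i) := fun i => by
    refine LipschitzWith.of_dist_le_mul fun x y => ?_
    refine le_trans ?_ (hV.dist_le_mul x y)
    rw [dist_eq_norm, dist_eq_norm]
    exact PiLp.norm_apply_le (V x - V y) i
  have hjb : ∀ x i j, |jac V x i j| ≤ K := fun x i j => by
    have := lipschitz_fderiv_apply_bound (hVi i) x (e3 j)
    simpa [e3, jac] using this
  have hSb : ∀ x, frobSq (jac V x + (jac V x)ᵀ) ≤ 9 * (2 * K) ^ 2 := fun x => by
    have : ∀ i j, ((jac V x + (jac V x)ᵀ) i j) ^ 2 ≤ (2 * K : ℝ) ^ 2 := fun i j => by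
      simp only [Matrix.add_apply, Matrix.transpose_apply]
      have a := abs_le.1 (hjb x i j)
      have b := abs_le.1 (hjb x j i)
      exact sq_le_sq' (by linarith) (by linarith)
    unfold frobSq
    refine (Finset.sum_le_sum fun i _ => Finset.sum_le_sum fun j _ => this i j).trans (le_of_eq ?_)
    simp
    ring
  obtain ⟨B, hB⟩ := (isCompact_closedBall (0 : E3) 1).exists_bound_of_continuousOn
    (hV.continuous.norm.pow 2).continuousOn
  have hVB : ∀ y ∈ ball (0 : E3) 1, ‖V y‖ ^ 2 ≤ B := fun y hy =>
    (le_abs_self _).trans (hB y (ball_subset_closedBall hy))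
  have hFB : ∀ y ∈ ball (0 : E3) 1, ‖F y‖ ≤ 9 * (2 * K) ^ 2 + B := fun y hy => by
    rw [Real.norm_of_nonneg (hF0 y)]
    exact add_le_add (hSb y) (hVB y hy)
  have hSi : IntegrableOn (fun x => frobSq (jac V x + (jac V x)ᵀ)) (ball (0 : E3) 1) := by
    refine IntegrableOn.of_bound measure_ball_lt_top (measurable_frobSq_jac V).aestronglyMeasurable
      (9 * (2 * K) ^ 2) (Filter.Eventually.of_forall fun x => ?_)
    rw [Real.norm_of_nonneg (frobSq_nonneg _)]
    exact hSb x
  have hVint : IntegrableOn (fun x => ‖V x‖ ^ 2) (ball (0 : E3) 1) := by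
    refine IntegrableOn.of_bound measure_ball_lt_top hVm.aestronglyMeasurable B ?_
    refine (ae_restrict_iff' measurableSet_ball).2 (Filter.Eventually.of_forall fun x hx => ?_)
    rw [Real.norm_of_nonneg (sq_nonneg _)]
    exact hVB x hx
  have hFi : IntegrableOn F (ball (0 : E3) 1) := hSi.add hVint
  have hann : volume ann < ⊤ :=
    lt_of_le_of_lt (measure_mono fun x hx => mem_ball_zero_iff.2 hx.2)
      (measure_ball_lt_top (x := (0 : E3)) (r := 3))
  have hFp : ∀ n, IntegrableOn (fun x => C * F (phiM (n + 1) x)) ann := fun n => by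
    refine Integrable.const_mul ?_ C
    refine IntegrableOn.of_bound hann (hFm.comp (measurable_phiM _)).aestronglyMeasurable
      (9 * (2 * K) ^ 2 + B) ?_
    exact (ae_restrict_iff' isOpen_ann.measurableSet).2 (Filter.Eventually.of_forall fun x hx =>
      hFB _ (phiM_mem n hx.1))
  have hcov1 := hc1 (fun y => C * F y) (fun x => C * F (phiM 1 x)) (fun y => mul_nonneg hC.le (hF0 y))
    (hFi.const_mul C) (fun x _ => mul_nonneg hC.le (hF0 _)) (fun x _ => le_rfl)
  have hcov2 := hc2 (fun y => C * F y) (fun x => C * F (phiM 2 x)) (fun y => mul_nonneg hC.le (hF0 y))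
    (hFi.const_mul C) (fun x _ => mul_nonneg hC.le (hF0 _)) (fun x _ => le_rfl)
  rw [integral_const_mul (μ := volume.restrict (ball 0 1))] at hcov1 hcov2
  have hannle : (∫ x in ann, frobSq (jac U x + (jac U x)ᵀ)) ≤
      (∫ x in ann, C * F (phiM 1 x)) + ∫ x in ann, C * F (phiM 2 x) := by
    rw [← integral_add (hFp 0) (hFp 1)]
    exact setIntegral_mono_on i2.integrableOn ((hFp 0).add (hFp 1)) isOpen_ann.measurableSet
      (fun x hx => hb V hVd x hx)
  have hcompl : (∫ x in (ball (0 : E3) 1)ᶜ, frobSq (jac U x + (jac U x)ᵀ)) =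
      ∫ x in ann, frobSq (jac U x + (jac U x)ᵀ) := by
    refine setIntegral_eq_of_subset_of_ae_sdiff_eq_zero measurableSet_ball.compl.nullMeasurableSet ?_ ?_
    · intro x hx
      simpa using hx.1.le
    · have hsph : ∀ᵐ x : E3, x ∉ sphere (0 : E3) 1 := by
        exact measure_eq_zero_iff_ae_notMem.1 (Measure.addHaar_sphere volume (0 : E3) 1)
      filter_upwards [hsph] with x hx hx'
      have h1 : 1 ≤ ‖x‖ := by simpa using hx'.1
      have h2 : ‖x‖ ≠ 1 := by simpa using hx
      have h3 : 3 ≤ ‖x‖ := by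
        by_contra h
        exact hx'.2 ⟨lt_of_le_of_ne h1 h2.symm, not_le.1 h⟩
      rw [hout x (by linarith)]
      simp [frobSq]
  have hsplit := integral_add_compl (measurableSet_ball (x := (0 : E3)) (ε := 1)) i2
  have hinS : (∫ x in ball (0 : E3) 1, frobSq (jac U x + (jac U x)ᵀ)) =
      ∫ x in ball (0 : E3) 1, frobSq (jac V x + (jac V x)ᵀ) :=
    setIntegral_congr_fun measurableSet_ball fun x hx => by simp only [hin x hx]
  have hinJ : (∫ x in ball (0 : E3) 1, frobSq (jac V x)) ≤ ∫ x, frobSq (jac U x) := by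
    rw [← setIntegral_congr_fun (f := fun x => frobSq (jac U x)) measurableSet_ball
      fun x hx => by simp only [hin x hx]]
    exact setIntegral_le_integral i1 (Filter.Eventually.of_forall fun x => frobSq_nonneg _)
  have hFsum : (∫ x in ball (0 : E3) 1, F x) = (∫ x in ball (0 : E3) 1, frobSq (jac V x + (jac V x)ᵀ)) +
      ∫ x in ball (0 : E3) 1, ‖V x‖ ^ 2 := integral_add hSi hVint
  have hVn : 0 ≤ ∫ x in ball (0 : E3) 1, ‖V x‖ ^ 2 := integral_nonneg fun x => sq_nonneg _
  rw [← hFsum]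
  rw [hcompl, hinS] at hsplit
  have : (∫ x in ball (0 : E3) 1, frobSq (jac V x + (jac V x)ᵀ)) ≤ ∫ x in ball (0 : E3) 1, F x := by
    rw [hFsum]; linarith
  nlinarith

theorem korn_inequality_unit_ball :
    ∃ C > (0 : ℝ), ∀ V : E3 → E3,
      ContDiffOn ℝ 1 V (closedBall (0 : E3) 1) →
      (∫ x in ball (0 : E3) 1, frobSq (jac V x)) ≤
        C * ((∫ x in ball (0 : E3) 1, frobSq (jac V x + (jac V x)ᵀ)) +
          ∫ x in ball (0 : E3) 1, ‖V x‖ ^ 2) := by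
  obtain ⟨C, hC, h⟩ := korn_lipschitz
  refine ⟨C, hC, fun V hV => ?_⟩
  obtain ⟨K, hK⟩ := (hV.locallyLipschitzOn (convex_closedBall _ _)).exists_lipschitzOnWith_of_compact
    (isCompact_closedBall (0 : E3) 1)
  obtain ⟨W, hW, hVW⟩ := hK.extend_finite_dimension
  have he : ∀ y ∈ ball (0 : E3) 1, W =ᶠ[nhds y] V := fun y hy => by
    filter_upwards [isOpen_ball.mem_nhds hy] with z hz
    exact (hVW (ball_subset_closedBall hz)).symm
  have hd : ∀ y ∈ ball (0 : E3) 1, DifferentiableAt ℝ W y := fun y hy => by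
    refine DifferentiableAt.congr_of_eventuallyEq ?_ (he y hy)
    exact ((hV.differentiableOn (by norm_num)) y (ball_subset_closedBall hy)).differentiableAt
      (Filter.mem_of_superset (isOpen_ball.mem_nhds hy) ball_subset_closedBall)
  have hj : ∀ y ∈ ball (0 : E3) 1, jac W y = jac V y := fun y hy => jac_congr (he y hy)
  have main := h W _ hW hd
  rw [setIntegral_congr_fun (f := fun x => frobSq (jac W x)) (g := fun x => frobSq (jac V x)) measurableSet_ball
      fun x hx => by simp only [hj x hx],
    setIntegral_congr_fun (f := fun x => frobSq (jac W x + (jac W x)ᵀ)) (g := fun x => frobSq (jac V x + (jac V x)ᵀ)) measurableSet_ball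
      fun x hx => by simp only [hj x hx],
    setIntegral_congr_fun (f := fun x => ‖W x‖ ^ 2) (g := fun x => ‖V x‖ ^ 2) measurableSet_ball
      fun x hx => by simp only [← hVW (ball_subset_closedBall hx)]] at main
  exact main

end
end

section
/- Poincaré inequality for tangent vector fields on the ball: there exists a constant C > 0 such that for every continuously differentiable vector field V : closure(B₁) → ℝ³ satisfying V(x)·x = 0 for all x with |x| = 1, ∫_{B₁} |V(x)|² dx ≤ C ∫_{B₁} |DV(x)|² dx. -/
/- Poincaré inequality for tangent vector fields on the unit ball:
`∫_{B₁} |V|² ≤ C ∫_{B₁} |DV|²` for C¹ vector fields `V` with `V·x = 0` on the unit sphere. -/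

open MeasureTheory Metric Finset Matrix

noncomputable section

abbrev cB : Set E3 := closedBall (0 : E3) 1

theorem aux_uniq : UniqueDiffOn ℝ cB :=
  uniqueDiffOn_convex (convex_closedBall _ _) (by
    rw [interior_closedBall _ one_ne_zero]; exact ⟨0, by simp⟩)

theorem aux_within {f : E3 → ℝ} {x : E3} (hx : x ∈ ball (0 : E3) 1) :
    fderivWithin ℝ f cB x = fderiv ℝ f x :=
  fderivWithin_of_mem_nhds (closedBall_mem_nhds_of_mem hx)

/-- The derivative integrand is continuous up to the boundary. -/
theorem aux_cont {f : E3 → ℝ} (hf : ContDiffOn ℝ 1 f cB) (v : E3) :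
    ContinuousOn (fun x => fderivWithin ℝ f cB x v) cB :=
  (hf.continuousOn_fderivWithin aux_uniq le_rfl).clm_apply continuousOn_const

theorem aux_int {f : E3 → ℝ} (hf : ContinuousOn f cB) : IntegrableOn f (ball (0 : E3) 1) :=
  (hf.integrableOn_compact (isCompact_closedBall _ _)).mono_set ball_subset_closedBall

theorem aux_sphere_dist {x y : E3} (hx : ‖x‖ ≤ 1) (hy : 1 < ‖y‖) :
    ∃ z : E3, ‖z‖ = 1 ∧ dist x z ≤ dist x y := by
  have h1 : ‖y‖ - ‖x‖ ≤ dist x y := by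
    rw [dist_comm, dist_eq_norm]; exact norm_sub_norm_le y x
  by_cases h0 : x = 0
  · refine ⟨‖y‖⁻¹ • y, ?_, ?_⟩
    · rw [norm_smul, norm_inv, norm_norm, inv_mul_cancel₀ (by linarith)]
    · have : ‖(‖y‖⁻¹ • y : E3)‖ = 1 := by
        rw [norm_smul, norm_inv, norm_norm, inv_mul_cancel₀ (by linarith)]
      subst h0
      rw [dist_zero_left, this, dist_zero_left]; exact hy.le
  · have hn : 0 < ‖x‖ := norm_pos_iff.2 h0
    refine ⟨‖x‖⁻¹ • x, ?_, ?_⟩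
    · rw [norm_smul, norm_inv, norm_norm, inv_mul_cancel₀ hn.ne']
    · have : x - ‖x‖⁻¹ • x = (1 - ‖x‖⁻¹) • x := by rw [sub_smul, one_smul]
      have h3 : 1 - ‖x‖⁻¹ ≤ 0 := by
        have := (one_le_inv₀ hn).2 hx
        linarith
      have h4 : dist x (‖x‖⁻¹ • x) = 1 - ‖x‖ := by
        rw [dist_eq_norm, this, norm_smul, Real.norm_eq_abs, abs_of_nonpos h3]
        field_simp
        ring
      linarith

/-- A `C¹` function on the closed ball vanishing on the sphere has partial derivatives of
integral zero. -/
theorem aux_zero {f : E3 → ℝ} (hf : ContDiffOn ℝ 1 f cB) (h0 : ∀ x : E3, ‖x‖ = 1 → f x = 0)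
    (v : E3) : ∫ x in ball (0 : E3) 1, fderiv ℝ f x v = 0 := by
  classical
  obtain ⟨K, hK⟩ : ∃ K, LipschitzOnWith K f cB :=
    hf.exists_lipschitzOnWith one_ne_zero (convex_closedBall _ _) (isCompact_closedBall _ _)
  set G : E3 → ℝ := cB.indicator f with hG
  have hin : ∀ x : E3, ‖x‖ ≤ 1 → G x = f x := fun x hx =>
    Set.indicator_of_mem (by simpa using hx) _
  have hout : ∀ x : E3, 1 < ‖x‖ → G x = 0 := fun x hx =>
    Set.indicator_of_notMem (by simpa using hx) _
  have key : ∀ x y : E3, ‖x‖ ≤ 1 → 1 < ‖y‖ → dist (G x) (G y) ≤ K * dist x y := by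
    intro x y hx hy
    obtain ⟨z, hz, hd⟩ := aux_sphere_dist hx hy
    have := hK.dist_le_mul x (by simpa using hx) z (by simp [hz])
    rw [h0 z hz] at this
    rw [hin x hx, hout y hy]
    exact this.trans (by gcongr)
  have hLip : LipschitzWith K G := by
    refine LipschitzWith.of_dist_le_mul fun x y => ?_
    rcases le_or_gt ‖x‖ 1 with hx | hx <;> rcases le_or_gt ‖y‖ 1 with hy | hy
    · rw [hin x hx, hin y hy]
      exact hK.dist_le_mul x (by simpa using hx) y (by simpa using hy)
    · exact key x y hx hy
    · rw [dist_comm, dist_comm x]; exact key y x hy hx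
    · rw [hout x hx, hout y hy, dist_self]; positivity
  have hcs : HasCompactSupport G :=
    HasCompactSupport.of_support_subset_isCompact (isCompact_closedBall (0 : E3) 1)
      Set.support_indicator_subset
  have hI := LipschitzWith.integral_lineDeriv_mul_eq (μ := (volume : Measure E3))
    (LipschitzWith.const' (K := 0) (1 : ℝ)) hLip hcs (-v)
  have hc : ∀ x : E3, lineDeriv ℝ (fun _ : E3 => (1 : ℝ)) x (-v) = 0 := fun x => by
    simp [lineDeriv]
  simp only [hc, zero_mul, integral_zero, neg_neg, mul_one] at hI
  have h2 : ∫ x in ball (0 : E3) 1, fderiv ℝ f x v = ∫ x, lineDeriv ℝ G x v := by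
    rw [← integral_indicator measurableSet_ball]
    refine integral_congr_ae ?_
    have hs : ∀ᵐ x : E3 ∂volume, x ∉ sphere (0 : E3) 1 :=
      measure_eq_zero_iff_ae_notMem.1 (Measure.addHaar_sphere _ _ _)
    filter_upwards [hs] with x hx
    rcases lt_trichotomy ‖x‖ 1 with h | h | h
    · have hxb : x ∈ ball (0 : E3) 1 := by simpa using h
      rw [Set.indicator_of_mem hxb]
      have he : G =ᶠ[nhds x] f := by
        filter_upwards [isOpen_ball.mem_nhds hxb] with y hy
        exact hin y (by simpa using (mem_ball.1 hy).le)
      have hd : DifferentiableAt ℝ f x :=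
        (hf.differentiableOn one_ne_zero).differentiableAt (closedBall_mem_nhds_of_mem hxb)
      have hd2 : DifferentiableAt ℝ G x := he.differentiableAt_iff.2 hd
      rw [hd2.lineDeriv_eq_fderiv, he.fderiv_eq]
    · exact absurd (by simpa using h) hx
    · rw [Set.indicator_of_notMem (by simpa using h.le)]
      have he : G =ᶠ[nhds x] fun _ => 0 := by
        filter_upwards [(isOpen_lt continuous_const continuous_norm).mem_nhds h] with y hy
        exact hout y hy
      have hd2 : DifferentiableAt ℝ G x :=
        he.differentiableAt_iff.2 (differentiableAt_const _)
      rw [hd2.lineDeriv_eq_fderiv, he.fderiv_eq]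
      simp
  rw [h2, ← hI]

/-- The pointwise algebraic inequality. -/
theorem aux_alg (a x : Fin 3 → ℝ) (J : Fin 3 → Fin 3 → ℝ) (hx : ∑ i, x i ^ 2 ≤ 1) :
    ∑ i, a i ^ 2 ≤ 2 * (∑ i, ((∑ k, a k * x k) * J i i +
      a i * (∑ k, (a k * e3 i k + x k * J k i)))) + 8 * ∑ i, ∑ j, J i j ^ 2 := by
  have hb : ∀ i, (∑ k, x k * J k i) ^ 2 ≤ ∑ k, J k i ^ 2 := fun i => by
    have h1 := Finset.sum_mul_sq_le_sq_mul_sq Finset.univ x (fun k => J k i)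
    have h2 : 0 ≤ ∑ k, J k i ^ 2 := Finset.sum_nonneg fun _ _ => sq_nonneg _
    nlinarith
  have hg : (∑ k, a k * x k) ^ 2 ≤ ∑ k, a k ^ 2 := by
    have h1 := Finset.sum_mul_sq_le_sq_mul_sq Finset.univ a x
    have h2 : 0 ≤ ∑ k, a k ^ 2 := Finset.sum_nonneg fun _ _ => sq_nonneg _
    nlinarith
  have e : ∀ i, ∑ k, (a k * e3 i k + x k * J k i) = a i + ∑ k, x k * J k i := fun i => by
    rw [Finset.sum_add_distrib]; simp [e3]
  simp only [e]
  have hb0 := hb 0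
  have hb1 := hb 1
  have hb2 := hb 2
  generalize (∑ k, a k * x k) = g at *
  generalize hB : (fun i => ∑ k, x k * J k i) = B at *
  have hB' : ∀ i, ∑ k, x k * J k i = B i := fun i => by rw [← hB]
  simp only [hB', Fin.sum_univ_three] at *
  nlinarith [sq_nonneg (a 0 + 2 * B 0), sq_nonneg (a 1 + 2 * B 1), sq_nonneg (a 2 + 2 * B 2),
    sq_nonneg (g + 2 * (J 0 0 + J 1 1 + J 2 2)), sq_nonneg (J 0 0 - J 1 1),
    sq_nonneg (J 0 0 - J 2 2), sq_nonneg (J 1 1 - J 2 2),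
    sq_nonneg (J 0 1), sq_nonneg (J 0 2), sq_nonneg (J 1 0), sq_nonneg (J 1 2),
    sq_nonneg (J 2 0), sq_nonneg (J 2 1)]

theorem poincare_inequality_tangent_fields :
    ∃ C > (0 : ℝ), ∀ V : E3 → E3,
      ContDiffOn ℝ 1 V (closedBall (0 : E3) 1) →
      (∀ x : E3, ‖x‖ = 1 → ∑ i, V x i * x i = 0) →
      (∫ x in ball (0 : E3) 1, ‖V x‖ ^ 2) ≤
        C * ∫ x in ball (0 : E3) 1, frobSq (jac V x) := by
  refine ⟨8, by norm_num, fun V hV hT => ?_⟩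
  have hVi : ∀ i, ContDiffOn ℝ 1 (fun x => V x i) cB := fun i =>
    contDiffOn_euclidean.1 hV i
  have hxi : ∀ i, ContDiff ℝ 1 (fun x : E3 => x i) := fun i =>
    contDiff_euclidean.1 contDiff_id i
  have hg : ContDiffOn ℝ 1 (fun x : E3 => ∑ k, V x k * x k) cB :=
    ContDiffOn.sum fun k _ => (hVi k).mul (hxi k).contDiffOn
  have hh : ∀ i, ContDiffOn ℝ 1 (fun x : E3 => (∑ k, V x k * x k) * V x i) cB := fun i =>
    hg.mul (hVi i)
  have hz : ∀ i, ∫ x in ball (0 : E3) 1,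
      fderiv ℝ (fun x : E3 => (∑ k, V x k * x k) * V x i) x (e3 i) = 0 := fun i =>
    aux_zero (hh i) (fun x hx => by rw [hT x hx, zero_mul]) _
  have hInt : ∀ i, IntegrableOn (fun x =>
      fderiv ℝ (fun x : E3 => (∑ k, V x k * x k) * V x i) x (e3 i)) (ball (0 : E3) 1) := fun i =>
    (aux_int (aux_cont (hh i) (e3 i))).congr_fun
      (fun x hx => by simp only [aux_within hx]) measurableSet_ball
  have hIQ : IntegrableOn (fun x => frobSq (jac V x)) (ball (0 : E3) 1) := by
    have hc : ContinuousOn (fun x => ∑ i, ∑ j,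
        (fderivWithin ℝ (fun y => V y i) cB x (e3 j)) ^ 2) cB :=
      continuousOn_finsetSum _ fun i _ => continuousOn_finsetSum _ fun j _ =>
        (aux_cont (hVi i) (e3 j)).pow 2
    exact (aux_int hc).congr_fun
      (fun x hx => by simp only [aux_within hx, frobSq, jac, Matrix.of_apply]) measurableSet_ball
  have hIV : IntegrableOn (fun x => ‖V x‖ ^ 2) (ball (0 : E3) 1) :=
    aux_int (hV.continuousOn.norm.pow 2)
  have hIS := integrable_finsetSum Finset.univ fun i _ => hInt i
  have hle : ∀ x ∈ ball (0 : E3) 1, ‖V x‖ ^ 2 ≤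
      2 * (∑ i, fderiv ℝ (fun x : E3 => (∑ k, V x k * x k) * V x i) x (e3 i)) +
        8 * frobSq (jac V x) := by
    intro x hx
    have hdV : ∀ i, HasFDerivAt (fun y => V y i) (fderiv ℝ (fun y => V y i) x) x := fun i =>
      (((hVi i).differentiableOn one_ne_zero).differentiableAt
        (closedBall_mem_nhds_of_mem hx)).hasFDerivAt
    have hdx : ∀ i, HasFDerivAt (fun y : E3 => y i)
        (EuclideanSpace.proj i : E3 →L[ℝ] ℝ) x := fun i =>
      (EuclideanSpace.proj i : E3 →L[ℝ] ℝ).hasFDerivAt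
    have hdg := HasFDerivAt.fun_sum (u := Finset.univ) fun k _ => (hdV k).fun_mul (hdx k)
    have hxs : ∑ i, x i ^ 2 ≤ 1 := by
      have h1 : ‖x‖ < 1 := by simpa using hx
      have h2 := EuclideanSpace.real_norm_sq_eq x
      rw [← h2]; nlinarith [norm_nonneg x]
    have := aux_alg (fun i => V x i) (fun i => x i)
      (fun i j => fderiv ℝ (fun y => V y i) x (e3 j)) hxs
    rw [EuclideanSpace.real_norm_sq_eq]
    convert this using 4 with i
    · rw [(hdg.fun_mul (hdV i)).fderiv]
      simp
    · rfl
  calc (∫ x in ball (0 : E3) 1, ‖V x‖ ^ 2)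
      ≤ ∫ x in ball (0 : E3) 1,
        (2 * (∑ i, fderiv ℝ (fun x : E3 => (∑ k, V x k * x k) * V x i) x (e3 i)) +
        8 * frobSq (jac V x)) :=
        setIntegral_mono_on hIV ((hIS.const_mul 2).add (hIQ.const_mul 8)) measurableSet_ball hle
    _ = 8 * ∫ x in ball (0 : E3) 1, frobSq (jac V x) := by
        rw [integral_add (hIS.const_mul 2) (hIQ.const_mul 8), integral_const_mul,
          integral_const_mul, integral_finsetSum _ fun i _ => hInt i]
        simp [hz]

end
end
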